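/- arXiv:2201.01612 — 6 statements merged into one kernel-verified Lean document; each statement's English description precedes it below -/
import Mathlib

section
/- Let B = A^{coH} ⊆ A be a faithfully flat H-Hopf–Galois extension with translation map τ, τ(h) = h^⟨1⟩ ⊗_B h^⟨2⟩. Then the space of coinvariants of the diagonal coaction, (A⊗A)^{coH}, coincides with the subspace C(A,H) = { Σᵢ aᵢ⊗ãᵢ ∈ A⊗A : Σᵢ (aᵢ)₍₀₎ ⊗ ((aᵢ)₍₁₎)^⟨1⟩ ⊗_B ((aᵢ)₍₁₎)^⟨2⟩·ãᵢ = Σᵢ aᵢ ⊗ (ãᵢ ⊗_B 1_A) in A ⊗ (A⊗_B A) }. -/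
/- Statement 0: For a faithfully flat Hopf–Galois extension `B = A^{co H} ⊆ A` with
translation map `τ`, the coinvariants of the diagonal coaction on `A ⊗ A` coincide with
the subspace `C(A,H) = {x : (id ⊗ (τ·))∘(δ⊗id) x = x ⊗ (1 ⊗_B 1-multiplied)}`, i.e.
`Σ a₍₀₎ ⊗ τ(a₍₁₎)·ã = Σ a ⊗ (ã ⊗_B 1)` in `A ⊗ (A ⊗_B A)`. -/

open TensorProduct

noncomputable section

variable {H A : Type} [Ring H] [HopfAlgebra ℂ H] [Ring A] [Algebra ℂ A]

/-- The coinvariant subalgebra `B = A^{co H}` of a comodule algebra. -/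
def coinvAlg (δ : A →ₐ[ℂ] A ⊗[ℂ] H) : Subalgebra ℂ A where
  carrier := {a | δ a = a ⊗ₜ[ℂ] (1 : H)}
  mul_mem' := by
    intro a b ha hb
    simp only [Set.mem_setOf_eq] at *
    rw [map_mul, ha, hb, Algebra.TensorProduct.tmul_mul_tmul, mul_one]
  one_mem' := by
    simp only [Set.mem_setOf_eq, map_one, Algebra.TensorProduct.one_def]
  add_mem' := by
    intro a b ha hb
    simp only [Set.mem_setOf_eq] at *
    rw [map_add, ha, hb, add_tmul]
  zero_mem' := by
    simp only [Set.mem_setOf_eq, map_zero, zero_tmul]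
  algebraMap_mem' := by
    intro c
    simp only [Set.mem_setOf_eq, Algebra.algebraMap_eq_smul_one, map_smul, map_one,
      Algebra.TensorProduct.one_def, smul_tmul']

/-- The diagonal coaction on `A ⊗ A`:  `a ⊗ ã ↦ a₍₀₎ ⊗ ã₍₀₎ ⊗ a₍₁₎ã₍₁₎`. -/
def diagCoaction (δ : A →ₐ[ℂ] A ⊗[ℂ] H) : A ⊗[ℂ] A →ₗ[ℂ] (A ⊗[ℂ] A) ⊗[ℂ] H :=
  (TensorProduct.map LinearMap.id (LinearMap.mul' ℂ H)) ∘ₗ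
    (TensorProduct.tensorTensorTensorComm ℂ A H A H).toLinearMap ∘ₗ
      (TensorProduct.map δ.toLinearMap δ.toLinearMap)

/-- The (unbalanced) canonical Galois map `ã ⊗ a ↦ ã a₍₀₎ ⊗ a₍₁₎`. -/
def chi0 (δ : A →ₐ[ℂ] A ⊗[ℂ] H) : A ⊗[ℂ] A →ₗ[ℂ] A ⊗[ℂ] H :=
  (TensorProduct.map (LinearMap.mul' ℂ A) LinearMap.id) ∘ₗ
    ((TensorProduct.assoc ℂ A A H).symm.toLinearMap) ∘ₗ
      (TensorProduct.map LinearMap.id δ.toLinearMap)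

/-- The relation submodule defining the balanced tensor product `A ⊗_B A`. -/
def galRel (δ : A →ₐ[ℂ] A ⊗[ℂ] H) : Submodule ℂ (A ⊗[ℂ] A) :=
  Submodule.span ℂ
    {x | ∃ (a a' b : A), b ∈ coinvAlg δ ∧ x = (a * b) ⊗ₜ[ℂ] a' - a ⊗ₜ[ℂ] (b * a')}

/-- `A ⊗_B A` as a quotient of `A ⊗ A`. -/
abbrev galQuot (δ : A →ₐ[ℂ] A ⊗[ℂ] H) := (A ⊗[ℂ] A) ⧸ galRel δ

/-- Multiplication on the second tensor factor: `(x ⊗ y) ⊗ a ↦ x ⊗ (y a)`. -/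
def secondMul : (A ⊗[ℂ] A) ⊗[ℂ] A →ₗ[ℂ] A ⊗[ℂ] A :=
  (TensorProduct.map LinearMap.id (LinearMap.mul' ℂ A)) ∘ₗ
    (TensorProduct.assoc ℂ A A A).toLinearMap

/-- The map `a ⊗ ã ↦ a₍₀₎ ⊗ τ(a₍₁₎)·ã ∈ A ⊗ (A ⊗_B A)`, where `τ0` is a lift of
the translation map. -/
def cMap (δ : A →ₐ[ℂ] A ⊗[ℂ] H) (τ0 : H →ₗ[ℂ] A ⊗[ℂ] A) :
    A ⊗[ℂ] A →ₗ[ℂ] A ⊗[ℂ] galQuot δ :=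
  (TensorProduct.map LinearMap.id
      ((galRel δ).mkQ ∘ₗ secondMul ∘ₗ (TensorProduct.map τ0 LinearMap.id))) ∘ₗ
    (TensorProduct.assoc ℂ A H A).toLinearMap ∘ₗ
      (TensorProduct.map δ.toLinearMap LinearMap.id)

/-- The map `a ⊗ ã ↦ a ⊗ (ã ⊗_B 1) ∈ A ⊗ (A ⊗_B A)`. -/
def cMap' (δ : A →ₐ[ℂ] A ⊗[ℂ] H) : A ⊗[ℂ] A →ₗ[ℂ] A ⊗[ℂ] galQuot δ :=
  TensorProduct.map LinearMap.id
    ((galRel δ).mkQ ∘ₗ ((TensorProduct.mk ℂ A A).flip 1))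

/-- The relation submodule defining `A ⊗_B M` for a left `B`-module `M`. -/
def bRel (δ : A →ₐ[ℂ] A ⊗[ℂ] H) (M : Type) [AddCommGroup M] [Module ℂ M]
    [Module ↥(coinvAlg δ) M] : Submodule ℂ (A ⊗[ℂ] M) :=
  Submodule.span ℂ
    {x | ∃ (a : A) (b : ↥(coinvAlg δ)) (m : M), x = (a * ↑b) ⊗ₜ[ℂ] m - a ⊗ₜ[ℂ] (b • m)}

lemma chi0_tmul (δ : A →ₐ[ℂ] A ⊗[ℂ] H) (a b : A) :
    chi0 δ (a ⊗ₜ[ℂ] b) = (a ⊗ₜ[ℂ] (1 : H)) * δ b := by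
  simp only [chi0, LinearMap.comp_apply, TensorProduct.map_tmul, LinearMap.id_apply,
    AlgHom.toLinearMap_apply, LinearEquiv.coe_coe]
  induction δ b using TensorProduct.induction_on with
  | zero => simp
  | tmul x y => simp
  | add x y hx hy => simp only [tmul_add, map_add, mul_add, hx, hy]

lemma chi0_secondMul (δ : A →ₐ[ℂ] A ⊗[ℂ] H) (t : A ⊗[ℂ] A) (c : A) :
    chi0 δ (secondMul (t ⊗ₜ[ℂ] c)) = chi0 δ t * δ c := by
  induction t using TensorProduct.induction_on with
  | zero => simp
  | tmul x y => simp [secondMul, chi0_tmul, mul_assoc]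
  | add x y hx hy => simp only [add_tmul, map_add, add_mul, hx, hy]

lemma lTensor_liftQ_chi0_cMap (δ : A →ₐ[ℂ] A ⊗[ℂ] H)
    (hker : galRel δ ≤ LinearMap.ker (chi0 δ)) (τ0 : H →ₗ[ℂ] A ⊗[ℂ] A)
    (hτ : ∀ h : H, chi0 δ (τ0 h) = (1 : A) ⊗ₜ[ℂ] h) (x : A ⊗[ℂ] A) :
    LinearMap.lTensor A ((galRel δ).liftQ (chi0 δ) hker) (cMap δ τ0 x)
      = TensorProduct.assoc ℂ A A H (diagCoaction δ x) := by
  induction x using TensorProduct.induction_on with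
  | zero => simp
  | add x y hx hy => simp only [map_add, hx, hy]
  | tmul a c =>
    simp only [cMap, diagCoaction, LinearMap.comp_apply, TensorProduct.map_tmul,
      LinearMap.id_apply, AlgHom.toLinearMap_apply, LinearEquiv.coe_coe]
    induction δ a using TensorProduct.induction_on with
    | zero => simp
    | add x y hx hy => simp only [add_tmul, map_add, hx, hy]
    | tmul x h =>
      simp only [TensorProduct.assoc_tmul, TensorProduct.map_tmul, LinearMap.comp_apply,
        LinearMap.id_apply, LinearMap.lTensor_tmul, Submodule.mkQ_apply,
        Submodule.liftQ_apply, chi0_secondMul, hτ]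
      induction δ c using TensorProduct.induction_on with
      | zero => simp
      | add u v hu hv => simp only [tmul_add, mul_add, map_add, hu, hv]
      | tmul u k => simp

lemma lTensor_liftQ_chi0_cMap' (δ : A →ₐ[ℂ] A ⊗[ℂ] H)
    (hker : galRel δ ≤ LinearMap.ker (chi0 δ)) (x : A ⊗[ℂ] A) :
    LinearMap.lTensor A ((galRel δ).liftQ (chi0 δ) hker) (cMap' δ x)
      = TensorProduct.assoc ℂ A A H (x ⊗ₜ[ℂ] (1 : H)) := by
  induction x using TensorProduct.induction_on with
  | zero => simp
  | add x y hx hy => simp only [add_tmul, map_add, hx, hy]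
  | tmul a c =>
    simp only [cMap', TensorProduct.map_tmul, LinearMap.comp_apply, LinearMap.id_apply,
      LinearMap.lTensor_tmul, Submodule.mkQ_apply, Submodule.liftQ_apply, LinearMap.flip_apply,
      TensorProduct.mk_apply, chi0_tmul, map_one, mul_one, TensorProduct.assoc_tmul]

theorem diag_coinvariants_eq_gauge_coring
    (δ : A →ₐ[ℂ] A ⊗[ℂ] H)
    -- coassociativity of the coaction
    (hcoassoc : ∀ a : A,
      (TensorProduct.map LinearMap.id (Coalgebra.comul (R := ℂ) (A := H))) (δ a)
        = (TensorProduct.assoc ℂ A H H) ((TensorProduct.map δ.toLinearMap LinearMap.id) (δ a)))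
    -- counitality of the coaction
    (hcounit : ∀ a : A,
      (TensorProduct.rid ℂ A)
        ((TensorProduct.map LinearMap.id (Coalgebra.counit (R := ℂ) (A := H))) (δ a)) = a)
    -- the canonical map descends to the balanced tensor product
    (hker : galRel δ ≤ LinearMap.ker (chi0 δ))
    -- the extension is Hopf--Galois: the canonical map `A ⊗_B A → A ⊗ H` is bijective
    (hGal : Function.Bijective ((galRel δ).liftQ (chi0 δ) hker))
    -- a lift of the translation map `τ`
    (τ0 : H →ₗ[ℂ] A ⊗[ℂ] A)
    (hτ : ∀ h : H, chi0 δ (τ0 h) = (1 : A) ⊗ₜ[ℂ] h)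
    -- `A` is faithfully flat as a `B = A^{co H}`-module: a map `F` of left `B`-modules is
    -- injective iff `id_A ⊗_B F` is injective
    (hff : ∀ (M N : Type) [AddCommGroup M] [AddCommGroup N] [Module ℂ M] [Module ℂ N]
      [Module ↥(coinvAlg δ) M] [Module ↥(coinvAlg δ) N]
      [IsScalarTower ℂ ↥(coinvAlg δ) M] [IsScalarTower ℂ ↥(coinvAlg δ) N]
      (F : M →ₗ[↥(coinvAlg δ)] N)
      (hF : bRel δ M ≤ Submodule.comap (LinearMap.lTensor A (F.restrictScalars ℂ)) (bRel δ N)),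
      Function.Injective F ↔
        Function.Injective
          (Submodule.mapQ (bRel δ M) (bRel δ N) (LinearMap.lTensor A (F.restrictScalars ℂ)) hF)) :
    ∀ x : A ⊗[ℂ] A,
      diagCoaction δ x = x ⊗ₜ[ℂ] (1 : H) ↔ cMap δ τ0 x = cMap' δ x := by
  intro x
  have hinj : Function.Injective
      (LinearMap.lTensor A ((galRel δ).liftQ (chi0 δ) hker)) :=
    Module.Flat.lTensor_preserves_injective_linearMap _ hGal.injective
  rw [← hinj.eq_iff, lTensor_liftQ_chi0_cMap δ hker τ0 hτ, lTensor_liftQ_chi0_cMap',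
    (TensorProduct.assoc ℂ A A H).injective.eq_iff]

end
end

section
/- Let H be a Hopf algebra over ℂ and let A be a right H-comodule algebra carrying a ℤⁿ-grading A = ⊕_{r∈ℤⁿ} A_r such that the product preserves the grading and the coaction satisfies δ(A_r) ⊆ A_r⊗H. Then A_θ = (A, m_θ) is again a right H-comodule algebra with the same coaction δ, i.e., δ(m_θ(a,ã)) = m_θ(a₍₀₎,ã₍₀₎) ⊗ a₍₁₎ã₍₁₎ for all a,ã ∈ A; moreover the coinvariant subspace B = A^{coH} is unchanged and is closed under m_θ, so B_θ = (B, m_θ) is a subalgebra of A_θ. -/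
/- Statement 5 (Scenario I): Let `H` be a Hopf algebra and `A` a right `H`-comodule
algebra with a ℤⁿ-grading preserved by the product and such that `δ(A_r) ⊆ A_r ⊗ H`.
Then `A_θ = (A, m_θ)` is again an `H`-comodule algebra for the same coaction:
`δ(m_θ(a,ã)) = m_θ(a₍₀₎,ã₍₀₎) ⊗ a₍₁₎ã₍₁₎`; the coinvariant subspace `B = A^{co H}`
is unchanged and closed under `m_θ`, giving the subalgebra `B_θ = (B, m_θ)`. -/

open TensorProduct DirectSum

noncomputable section

/-- The phase factor `λ_θ(r,l) = exp(πi⟨θr,l⟩)`. -/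
def phase {n : ℕ} (θ : Matrix (Fin n) (Fin n) ℝ) (r l : Fin n → ℤ) : ℂ :=
  Complex.exp ((Real.pi : ℂ) * Complex.I * ∑ j, ∑ k, (θ j k : ℂ) * (r k : ℂ) * (l j : ℂ))

/-- The deformation of the product of a graded algebra by a "bi-character" `c`:
the bilinear extension of `a_r ⊗ ã_l ↦ c r l • (a_r * ã_l)` on homogeneous elements. -/
def defMul {ι : Type} [DecidableEq ι] {A : Type} [Ring A] [Algebra ℂ A]
    (𝒜 : ι → Submodule ℂ A) [DirectSum.Decomposition 𝒜] (c : ι → ι → ℂ) :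
    A →ₗ[ℂ] A →ₗ[ℂ] A :=
  let bil : (⨁ r, ↥(𝒜 r)) →ₗ[ℂ] (⨁ l, ↥(𝒜 l)) →ₗ[ℂ] A :=
    DirectSum.toModule ℂ ι _ (fun r =>
      (DirectSum.toModule ℂ ι (↥(𝒜 r) →ₗ[ℂ] A) (fun l =>
        (c r l • ((LinearMap.mul ℂ A).compl₁₂ (𝒜 r).subtype (𝒜 l).subtype)).flip)).flip)
  let dec : A →ₗ[ℂ] ⨁ r, ↥(𝒜 r) := (DirectSum.decomposeLinearEquiv 𝒜).toLinearMap
  (bil ∘ₗ dec).compl₂ dec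

theorem defMul_of_mem {ι : Type} [DecidableEq ι] {A : Type} [Ring A] [Algebra ℂ A]
    (𝒜 : ι → Submodule ℂ A) [DirectSum.Decomposition 𝒜] (c : ι → ι → ℂ) {r l : ι} {a a' : A}
    (ha : a ∈ 𝒜 r) (ha' : a' ∈ 𝒜 l) :
    defMul 𝒜 c a a' = c r l • (a * a') := by
  lift a to 𝒜 r using ha
  lift a' to 𝒜 l using ha'
  simp [defMul]

/-- On `A_r ⊗ H` and `A_l ⊗ H` the deformed product of `A ⊗ H` is `c r l` times the usual one. -/
theorem map₂_defMul_of_mem_range {ι : Type} [DecidableEq ι] {H A : Type} [Ring H] [Algebra ℂ H]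
    [Ring A] [Algebra ℂ A] (𝒜 : ι → Submodule ℂ A) [DirectSum.Decomposition 𝒜] (c : ι → ι → ℂ)
    {r l : ι} {x y : A ⊗[ℂ] H}
    (hx : x ∈ LinearMap.range (TensorProduct.map (𝒜 r).subtype (LinearMap.id (M := H))))
    (hy : y ∈ LinearMap.range (TensorProduct.map (𝒜 l).subtype (LinearMap.id (M := H)))) :
    TensorProduct.map₂ (defMul 𝒜 c) (LinearMap.mul ℂ H) x y = c r l • (x * y) := by
  obtain ⟨x, rfl⟩ := hx
  obtain ⟨y, rfl⟩ := hy
  induction x with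
  | zero => simp
  | add x₁ x₂ h₁ h₂ => simp only [map_add, LinearMap.add_apply, add_mul, smul_add, h₁, h₂]
  | tmul a h =>
    induction y with
    | zero => simp
    | add y₁ y₂ h₁ h₂ => simp only [map_add, mul_add, smul_add, h₁, h₂]
    | tmul a' h' =>
      simp [defMul_of_mem 𝒜 c a.2 a'.2, TensorProduct.smul_tmul']

theorem deformed_comodule_algebra {n : ℕ} (θ : Matrix (Fin n) (Fin n) ℝ)
    (hθ : ∀ j k, θ k j = - θ j k)
    {H A : Type} [Ring H] [HopfAlgebra ℂ H] [Ring A] [Algebra ℂ A]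
    (𝒜 : (Fin n → ℤ) → Submodule ℂ A) [GradedAlgebra 𝒜]
    (δ : A →ₐ[ℂ] A ⊗[ℂ] H)
    (hcoassoc : ∀ a : A,
      (TensorProduct.map LinearMap.id (Coalgebra.comul (R := ℂ) (A := H))) (δ a)
        = (TensorProduct.assoc ℂ A H H) ((TensorProduct.map δ.toLinearMap LinearMap.id) (δ a)))
    (hcounit : ∀ a : A,
      (TensorProduct.rid ℂ A)
        ((TensorProduct.map LinearMap.id (Coalgebra.counit (R := ℂ) (A := H))) (δ a)) = a)
    -- the coaction preserves the grading: `δ(A_r) ⊆ A_r ⊗ H`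
    (hgrad : ∀ (r : Fin n → ℤ) (a : A), a ∈ 𝒜 r →
      δ a ∈ LinearMap.range (TensorProduct.map (𝒜 r).subtype (LinearMap.id (M := H)))) :
    -- the same coaction is an algebra map for the deformed product
    (∀ a a' : A,
      δ (defMul 𝒜 (phase θ) a a')
        = TensorProduct.map₂ (defMul 𝒜 (phase θ)) (LinearMap.mul ℂ H) (δ a) (δ a')) ∧
    -- the coinvariant subspace is unchanged and closed under the deformed product
    (∀ a a' : A, δ a = a ⊗ₜ[ℂ] (1 : H) → δ a' = a' ⊗ₜ[ℂ] (1 : H) →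
      δ (defMul 𝒜 (phase θ) a a') = (defMul 𝒜 (phase θ) a a') ⊗ₜ[ℂ] (1 : H)) := by
  have hmul (a a' : A) : δ (defMul 𝒜 (phase θ) a a')
      = TensorProduct.map₂ (defMul 𝒜 (phase θ)) (LinearMap.mul ℂ H) (δ a) (δ a') := by
    induction a using DirectSum.Decomposition.inductionOn 𝒜 with
    | zero => simp
    | add a₁ a₂ h₁ h₂ => simp only [map_add, LinearMap.add_apply, h₁, h₂]
    | @homogeneous r a =>
      induction a' using DirectSum.Decomposition.inductionOn 𝒜 with
      | zero => simp
      | add a₁ a₂ h₁ h₂ => simp only [map_add, h₁, h₂]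
      | @homogeneous l a' =>
        rw [defMul_of_mem 𝒜 _ a.2 a'.2, map_smul, map_mul,
          map₂_defMul_of_mem_range 𝒜 _ (hgrad r a a.2) (hgrad l a' a'.2)]
  refine ⟨hmul, fun a a' ha ha' => ?_⟩
  simp [hmul, ha, ha']

end
end

section
/- Let H be a Hopf algebra over ℂ with a ℤⁿ×ℤⁿ-grading satisfying conditions (i) and (ii) below, and let ·_Θ be the deformed product. Then the undeformed coproduct Δ is an algebra homomorphism for ·_Θ: for all h, g ∈ H one has Δ(h ·_Θ g) = (h₍₁₎ ·_Θ g₍₁₎) ⊗ (h₍₂₎ ·_Θ g₍₂₎), where H⊗H carries the componentwise ·_Θ product. -/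
/- Statement 7 (Scenario II): For a Hopf algebra H with a ℤⁿ×ℤⁿ-bigrading such that
multiplication adds degrees and Δ(H_{(r,l)}) ⊆ ⊕_s H_{(r,s)}⊗H_{(s,l)}, the undeformed
coproduct Δ is an algebra homomorphism for the deformed product ·_Θ. -/

open TensorProduct DirectSum

noncomputable section

/-- The phase factor for the matrix `Θ = diag(θ, -θ)` on the bigrading:
`λ_Θ((r₁,r₂),(l₁,l₂)) = λ_θ(r₁,l₁)·λ_{-θ}(r₂,l₂)`. -/
def phaseTheta {n : ℕ} (θ : Matrix (Fin n) (Fin n) ℝ)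
    (r l : (Fin n → ℤ) × (Fin n → ℤ)) : ℂ :=
  phase θ r.1 l.1 * phase (-θ) r.2 l.2

theorem defMul_apply_of_mem {ι : Type} [DecidableEq ι] {A : Type} [Ring A] [Algebra ℂ A]
    (𝒜 : ι → Submodule ℂ A) [DirectSum.Decomposition 𝒜] (c : ι → ι → ℂ)
    {r l : ι} {a b : A} (ha : a ∈ 𝒜 r) (hb : b ∈ 𝒜 l) :
    defMul 𝒜 c a b = c r l • (a * b) := by
  lift a to 𝒜 r using ha
  lift b to 𝒜 l using hb
  simp only [defMul, LinearMap.compl₂_apply, LinearMap.comp_apply, LinearEquiv.coe_coe,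
    DirectSum.decomposeLinearEquiv_apply, DirectSum.decompose_coe]
  simp [← DirectSum.lof_eq_of ℂ, DirectSum.toModule_lof]

theorem phase_mul_phase_neg {n : ℕ} (θ : Matrix (Fin n) (Fin n) ℝ) (r l : Fin n → ℤ) :
    phase θ r l * phase (-θ) r l = 1 := by
  simp [phase, ← Complex.exp_add]

theorem phaseTheta_mul_phaseTheta {n : ℕ} (θ : Matrix (Fin n) (Fin n) ℝ)
    (r s l p t q : Fin n → ℤ) :
    phaseTheta θ (r, s) (p, t) * phaseTheta θ (s, l) (t, q) = phaseTheta θ (r, l) (p, q) := by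
  simp only [phaseTheta]
  linear_combination phase θ r p * phase (-θ) l q * phase_mul_phase_neg θ s t

/-- On tensors with matching inner degrees, the componentwise deformed product is the
undeformed one up to the phase of the outer degrees. -/
theorem map₂_defMul_phaseTheta {n : ℕ} (θ : Matrix (Fin n) (Fin n) ℝ)
    {A : Type} [Ring A] [Algebra ℂ A]
    (𝒜 : (Fin n → ℤ) × (Fin n → ℤ) → Submodule ℂ A) [DirectSum.Decomposition 𝒜]
    {r l p q : Fin n → ℤ} {x y : A ⊗[ℂ] A}
    (hx : x ∈ ⨆ s : Fin n → ℤ,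
      LinearMap.range (TensorProduct.map (𝒜 (r, s)).subtype (𝒜 (s, l)).subtype))
    (hy : y ∈ ⨆ t : Fin n → ℤ,
      LinearMap.range (TensorProduct.map (𝒜 (p, t)).subtype (𝒜 (t, q)).subtype)) :
    TensorProduct.map₂ (defMul 𝒜 (phaseTheta θ)) (defMul 𝒜 (phaseTheta θ)) x y
      = phaseTheta θ (r, l) (p, q) • (x * y) := by
  induction hx using Submodule.iSup_induction' with
  | zero => simp
  | add x x' _ _ hx hx' => simp only [map_add, LinearMap.add_apply, hx, hx', add_mul, smul_add]
  | mem s x hx =>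
    induction hy using Submodule.iSup_induction' with
    | zero => simp
    | add y y' _ _ hy hy' => simp only [map_add, hy, hy', mul_add, smul_add]
    | mem t y hy =>
      obtain ⟨x, rfl⟩ := hx
      obtain ⟨y, rfl⟩ := hy
      induction x with
      | zero => simp
      | add x x' hx hx' => simp only [map_add, LinearMap.add_apply, hx, hx', add_mul, smul_add]
      | tmul a b =>
        induction y with
        | zero => simp
        | add y y' hy hy' => simp only [map_add, hy, hy', mul_add, smul_add]
        | tmul a' b' =>
          simp only [TensorProduct.map_tmul, Submodule.subtype_apply, TensorProduct.map₂_apply_tmul,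
            Algebra.TensorProduct.tmul_mul_tmul, defMul_apply_of_mem 𝒜 _ a.2 a'.2,
            defMul_apply_of_mem 𝒜 _ b.2 b'.2, TensorProduct.smul_tmul_smul,
            phaseTheta_mul_phaseTheta]

theorem comul_algHom_deformed {n : ℕ} (θ : Matrix (Fin n) (Fin n) ℝ)
    (hθ : ∀ j k, θ k j = - θ j k)
    {H : Type} [Ring H] [HopfAlgebra ℂ H]
    (ℋ : (Fin n → ℤ) × (Fin n → ℤ) → Submodule ℂ H) [GradedAlgebra ℋ]
    -- (ii) the coproduct is compatible with the bigrading
    (hΔ : ∀ (r l : Fin n → ℤ), ∀ h ∈ ℋ (r, l),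
      Coalgebra.comul (R := ℂ) h ∈
        ⨆ s : Fin n → ℤ,
          LinearMap.range (TensorProduct.map (ℋ (r, s)).subtype (ℋ (s, l)).subtype)) :
    ∀ h g : H,
      Coalgebra.comul (R := ℂ) (defMul ℋ (phaseTheta θ) h g)
        = TensorProduct.map₂ (defMul ℋ (phaseTheta θ)) (defMul ℋ (phaseTheta θ))
            (Coalgebra.comul (R := ℂ) h) (Coalgebra.comul (R := ℂ) g) := by
  intro h g
  induction h using DirectSum.Decomposition.inductionOn ℋ with
  | zero => simp
  | add h h' hh hh' => simp only [map_add, LinearMap.add_apply, hh, hh']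
  | @homogeneous i h =>
    induction g using DirectSum.Decomposition.inductionOn ℋ with
    | zero => simp
    | add g g' hg hg' => simp only [map_add, hg, hg']
    | @homogeneous j g =>
      rw [map₂_defMul_phaseTheta θ ℋ (hΔ i.1 i.2 h h.2) (hΔ j.1 j.2 g g.2),
        defMul_apply_of_mem ℋ _ h.2 g.2, map_smul, Bialgebra.comul_mul]

end
end

section
/- Let H be a Hopf algebra over ℂ with a ℤⁿ×ℤⁿ-grading satisfying conditions (i)–(iv) below, and θ a real skew-symmetric n×n matrix. Then H_Θ = (H, ·_Θ, Δ, ε, S), with the deformed product and the unchanged coproduct, counit and antipode, is again a Hopf algebra; in particular the antipode identity S(h₍₁₎) ·_Θ h₍₂₎ = ε(h)·1 = h₍₁₎ ·_Θ S(h₍₂₎) holds for all h ∈ H. -/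
/- Statement 8 (Scenario II): For a Hopf algebra H with a ℤⁿ×ℤⁿ-bigrading satisfying
conditions (i)-(iv), the deformed product ·_Θ together with the unchanged coproduct,
counit and antipode again forms a Hopf algebra H_Θ; in particular the antipode identity
S(h₁) ·_Θ h₂ = ε(h)1 = h₁ ·_Θ S(h₂) holds. -/

open TensorProduct DirectSum

noncomputable section

theorem phase_add_left {n : ℕ} (θ : Matrix (Fin n) (Fin n) ℝ) (r s l : Fin n → ℤ) :
    phase θ (r + s) l = phase θ r l * phase θ s l := by
  simp only [phase, ← Complex.exp_add, ← mul_add, ← Finset.sum_add_distrib]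
  congr 2
  refine Finset.sum_congr rfl fun j _ => Finset.sum_congr rfl fun k _ => ?_
  simp only [Pi.add_apply, Int.cast_add]
  ring

theorem phase_add_right {n : ℕ} (θ : Matrix (Fin n) (Fin n) ℝ) (r l m : Fin n → ℤ) :
    phase θ r (l + m) = phase θ r l * phase θ r m := by
  simp only [phase, ← Complex.exp_add, ← mul_add, ← Finset.sum_add_distrib]
  congr 2
  refine Finset.sum_congr rfl fun j _ => Finset.sum_congr rfl fun k _ => ?_
  simp only [Pi.add_apply, Int.cast_add]

theorem phase_neg_left {n : ℕ} (θ : Matrix (Fin n) (Fin n) ℝ) (r l : Fin n → ℤ) :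
    phase θ (-r) l = phase (-θ) r l := by
  simp [phase]

theorem phase_neg_right {n : ℕ} (θ : Matrix (Fin n) (Fin n) ℝ) (r l : Fin n → ℤ) :
    phase θ r (-l) = phase (-θ) r l := by
  simp [phase]

theorem phase_zero_left {n : ℕ} (θ : Matrix (Fin n) (Fin n) ℝ) (l : Fin n → ℤ) :
    phase θ 0 l = 1 := by
  simp [phase]

theorem phase_zero_right {n : ℕ} (θ : Matrix (Fin n) (Fin n) ℝ) (r : Fin n → ℤ) :
    phase θ r 0 = 1 := by
  simp [phase]

theorem phase_self {n : ℕ} {θ : Matrix (Fin n) (Fin n) ℝ} (hθ : ∀ j k, θ k j = -θ j k)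
    (r : Fin n → ℤ) : phase θ r r = 1 := by
  have key : ∑ j, ∑ k, (θ j k : ℂ) * (r k : ℂ) * (r j : ℂ) = 0 := by
    rw [← self_eq_neg, ← Finset.sum_neg_distrib]
    conv_lhs => rw [Finset.sum_comm]
    refine Finset.sum_congr rfl fun j _ => ?_
    rw [← Finset.sum_neg_distrib]
    refine Finset.sum_congr rfl fun k _ => ?_
    rw [hθ j k]
    push_cast
    ring
  rw [phase, key, mul_zero, Complex.exp_zero]

theorem phase_neg_matrix_self {n : ℕ} {θ : Matrix (Fin n) (Fin n) ℝ}
    (hθ : ∀ j k, θ k j = -θ j k) (r : Fin n → ℤ) : phase (-θ) r r = 1 :=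
  phase_self (fun j k => by simp [hθ j k]) r

theorem phaseTheta_add_left {n : ℕ} (θ : Matrix (Fin n) (Fin n) ℝ)
    (r s l : (Fin n → ℤ) × (Fin n → ℤ)) :
    phaseTheta θ (r + s) l = phaseTheta θ r l * phaseTheta θ s l := by
  simp only [phaseTheta, Prod.fst_add, Prod.snd_add, phase_add_left]
  ring

theorem phaseTheta_add_right {n : ℕ} (θ : Matrix (Fin n) (Fin n) ℝ)
    (r l m : (Fin n → ℤ) × (Fin n → ℤ)) :
    phaseTheta θ r (l + m) = phaseTheta θ r l * phaseTheta θ r m := by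
  simp only [phaseTheta, Prod.fst_add, Prod.snd_add, phase_add_right]
  ring

/-- Two linear maps on `A ⊗ A` agree on a sum of tensor products of submodules as soon as they
agree on the pure tensors from each summand. -/
theorem LinearMap.eq_of_mem_iSup_range_map {κ : Type*} {A M : Type*} [AddCommGroup A]
    [Module ℂ A] [AddCommGroup M] [Module ℂ M] (P Q : κ → Submodule ℂ A)
    {f g : A ⊗[ℂ] A →ₗ[ℂ] M} (hfg : ∀ s, ∀ a ∈ P s, ∀ b ∈ Q s, f (a ⊗ₜ b) = g (a ⊗ₜ b))
    {x : A ⊗[ℂ] A}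
    (hx : x ∈ ⨆ s, LinearMap.range (TensorProduct.map (P s).subtype (Q s).subtype)) :
    f x = g x := by
  have hle : (⨆ s, LinearMap.range (TensorProduct.map (P s).subtype (Q s).subtype)) ≤
      LinearMap.eqLocus f g := by
    refine iSup_le fun s => ?_
    rintro _ ⟨y, rfl⟩
    rw [LinearMap.mem_eqLocus]
    induction y with
    | zero => simp
    | add y z hy hz => simp only [map_add, hy, hz]
    | tmul a b => exact hfg s a a.2 b b.2
  exact hle hx

theorem deformed_hopf_algebra {n : ℕ} (θ : Matrix (Fin n) (Fin n) ℝ)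
    (hθ : ∀ j k, θ k j = - θ j k)
    {H : Type} [Ring H] [HopfAlgebra ℂ H]
    (ℋ : (Fin n → ℤ) × (Fin n → ℤ) → Submodule ℂ H) [GradedAlgebra ℋ]
    -- (ii) the coproduct is compatible with the bigrading
    (hΔ : ∀ (r l : Fin n → ℤ), ∀ h ∈ ℋ (r, l),
      Coalgebra.comul (R := ℂ) h ∈
        ⨆ s : Fin n → ℤ,
          LinearMap.range (TensorProduct.map (ℋ (r, s)).subtype (ℋ (s, l)).subtype))
    -- (iii) the counit vanishes off the "diagonal" part of the bigrading
    (hε : ∀ (r l : Fin n → ℤ), r ≠ l → ∀ h ∈ ℋ (r, l),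
      Coalgebra.counit (R := ℂ) h = (0 : ℂ))
    -- (iv) the antipode maps `H_{(r,l)}` into `H_{(-l,-r)}`
    (hS : ∀ (r l : Fin n → ℤ), ∀ h ∈ ℋ (r, l),
      HopfAlgebra.antipode (R := ℂ) h ∈ ℋ (-l, -r)) :
    -- the deformed product is associative with unit `1`
    (∀ h g k : H,
      defMul ℋ (phaseTheta θ) (defMul ℋ (phaseTheta θ) h g) k
        = defMul ℋ (phaseTheta θ) h (defMul ℋ (phaseTheta θ) g k)) ∧
    (∀ h : H, defMul ℋ (phaseTheta θ) 1 h = h ∧ defMul ℋ (phaseTheta θ) h 1 = h) ∧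
    -- the (unchanged) coproduct is an algebra map for the deformed product
    (∀ h g : H,
      Coalgebra.comul (R := ℂ) (defMul ℋ (phaseTheta θ) h g)
        = TensorProduct.map₂ (defMul ℋ (phaseTheta θ)) (defMul ℋ (phaseTheta θ))
            (Coalgebra.comul (R := ℂ) h) (Coalgebra.comul (R := ℂ) g)) ∧
    -- the (unchanged) counit is an algebra map for the deformed product
    (∀ h g : H,
      Coalgebra.counit (R := ℂ) (defMul ℋ (phaseTheta θ) h g)
        = Coalgebra.counit (R := ℂ) h * Coalgebra.counit (R := ℂ) g) ∧
    -- the antipode identity `S(h₍₁₎) ·_Θ h₍₂₎ = ε(h)1 = h₍₁₎ ·_Θ S(h₍₂₎)`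
    (∀ h : H,
      TensorProduct.lift (defMul ℋ (phaseTheta θ))
          ((TensorProduct.map (HopfAlgebra.antipode (R := ℂ)) LinearMap.id)
            (Coalgebra.comul (R := ℂ) h))
        = Coalgebra.counit (R := ℂ) h • (1 : H) ∧
      TensorProduct.lift (defMul ℋ (phaseTheta θ))
          ((TensorProduct.map LinearMap.id (HopfAlgebra.antipode (R := ℂ)))
            (Coalgebra.comul (R := ℂ) h))
        = Coalgebra.counit (R := ℂ) h • (1 : H)) := by
  set D := defMul ℋ (phaseTheta θ)
  have hmul : ∀ {r l} {a b : H}, a ∈ ℋ r → b ∈ ℋ l → D a b = phaseTheta θ r l • (a * b) :=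
    fun ha hb => defMul_apply_of_mem ℋ _ ha hb
  refine ⟨fun h g k => ?_, fun h => ?_, fun h g => ?_, fun h g => ?_, fun h => ?_⟩
  · induction h using DirectSum.Decomposition.inductionOn ℋ with
    | zero => simp
    | add a b ha hb => simp only [map_add, LinearMap.add_apply, ha, hb]
    | @homogeneous r a =>
    induction g using DirectSum.Decomposition.inductionOn ℋ with
    | zero => simp
    | add a b ha hb => simp only [map_add, LinearMap.add_apply, ha, hb]
    | @homogeneous l b =>
    induction k using DirectSum.Decomposition.inductionOn ℋ with
    | zero => simp
    | add a b ha hb => simp only [map_add, ha, hb]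
    | @homogeneous m c =>
    rw [hmul a.2 b.2, hmul b.2 c.2, map_smul, map_smul, LinearMap.smul_apply,
      hmul (SetLike.mul_mem_graded a.2 b.2) c.2, hmul a.2 (SetLike.mul_mem_graded b.2 c.2),
      smul_smul, smul_smul, phaseTheta_add_left, phaseTheta_add_right, mul_assoc (a : H)]
    congr 1
    ring
  · induction h using DirectSum.Decomposition.inductionOn ℋ with
    | zero => simp
    | add a b ha hb => simp only [map_add, LinearMap.add_apply, ha, hb, and_self]
    | @homogeneous r a =>
    rw [hmul (SetLike.one_mem_graded ℋ) a.2, hmul a.2 (SetLike.one_mem_graded ℋ)]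
    simp [phaseTheta, phase_zero_left, phase_zero_right]
  · induction h using DirectSum.Decomposition.inductionOn ℋ with
    | zero => simp
    | add a b ha hb => simp only [map_add, LinearMap.add_apply, ha, hb]
    | @homogeneous i a =>
    induction g using DirectSum.Decomposition.inductionOn ℋ with
    | zero => simp
    | add a b ha hb => simp only [map_add, ha, hb]
    | @homogeneous j b =>
    obtain ⟨r, l⟩ := i
    obtain ⟨p, q⟩ := j
    rw [hmul a.2 b.2, map_smul, Bialgebra.comul_mul]
    refine LinearMap.eq_of_mem_iSup_range_map _ _
      (f := phaseTheta θ (r, l) (p, q) •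
        (LinearMap.mul ℂ (H ⊗[ℂ] H)).flip (Coalgebra.comul (R := ℂ) (b : H)))
      (g := (TensorProduct.map₂ D D).flip (Coalgebra.comul (R := ℂ) (b : H)))
      (fun s x hx y hy => ?_) (hΔ r l a a.2)
    refine LinearMap.eq_of_mem_iSup_range_map _ _
      (f := phaseTheta θ (r, l) (p, q) • LinearMap.mul ℂ (H ⊗[ℂ] H) (x ⊗ₜ y))
      (g := TensorProduct.map₂ D D (x ⊗ₜ y)) (fun t z hz w hw => ?_) (hΔ p q b b.2)
    rw [TensorProduct.map₂_apply_tmul, TensorProduct.map_tmul, hmul hx hz, hmul hy hw,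
      LinearMap.smul_apply, LinearMap.mul_apply', Algebra.TensorProduct.tmul_mul_tmul,
      TensorProduct.smul_tmul_smul]
    congr 1
    simp only [phaseTheta]
    linear_combination (-phase θ r p * phase (-θ) l q) * phase_mul_phase_neg θ s t
  · induction h using DirectSum.Decomposition.inductionOn ℋ with
    | zero => simp
    | add a b ha hb => simp only [map_add, LinearMap.add_apply, ha, hb, add_mul]
    | @homogeneous i a =>
    induction g using DirectSum.Decomposition.inductionOn ℋ with
    | zero => simp
    | add a b ha hb => simp only [map_add, ha, hb, mul_add]
    | @homogeneous j b =>
    obtain ⟨r, l⟩ := i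
    obtain ⟨p, q⟩ := j
    rw [hmul a.2 b.2, map_smul, Bialgebra.counit_mul, smul_eq_mul]
    by_cases hrl : r = l
    · by_cases hpq : p = q
      · subst hrl hpq
        rw [phaseTheta, phase_mul_phase_neg, one_mul]
      · simp [hε p q hpq b b.2]
    · simp [hε r l hrl a a.2]
  · induction h using DirectSum.Decomposition.inductionOn ℋ with
    | zero => simp
    | add a b ha hb => simp only [map_add, ha, hb, add_smul, and_self]
    | @homogeneous i a =>
    obtain ⟨r, l⟩ := i
    have hphase : phase (-θ) r l • Coalgebra.counit (R := ℂ) (a : H) • (1 : H) =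
        Coalgebra.counit (R := ℂ) (a : H) • (1 : H) ∧
        phase θ r l • Coalgebra.counit (R := ℂ) (a : H) • (1 : H) =
        Coalgebra.counit (R := ℂ) (a : H) • (1 : H) := by
      by_cases hrl : r = l
      · subst hrl
        simp [phase_self hθ, phase_neg_matrix_self hθ]
      · simp [hε r l hrl a a.2]
    constructor
    · trans phase θ r l • LinearMap.mul' ℂ H
        ((HopfAlgebra.antipode ℂ (A := H)).rTensor H (Coalgebra.comul (R := ℂ) (a : H)))
      · refine LinearMap.eq_of_mem_iSup_range_map _ _
          (f := TensorProduct.lift D ∘ₗ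
            TensorProduct.map (HopfAlgebra.antipode ℂ (A := H)) LinearMap.id)
          (g := phase θ r l • LinearMap.mul' ℂ H ∘ₗ
            (HopfAlgebra.antipode ℂ (A := H)).rTensor H)
          (fun s x hx y hy => ?_) (hΔ r l a a.2)
        simp [hmul (hS r s x hx) hy, phaseTheta, phase_neg_left, phase_neg_matrix_self hθ]
      · rw [HopfAlgebra.mul_antipode_rTensor_comul_apply, Algebra.algebraMap_eq_smul_one,
          hphase.2]
    · trans phase (-θ) r l • LinearMap.mul' ℂ H
        ((HopfAlgebra.antipode ℂ (A := H)).lTensor H (Coalgebra.comul (R := ℂ) (a : H)))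
      · refine LinearMap.eq_of_mem_iSup_range_map _ _
          (f := TensorProduct.lift D ∘ₗ
            TensorProduct.map LinearMap.id (HopfAlgebra.antipode ℂ (A := H)))
          (g := phase (-θ) r l • LinearMap.mul' ℂ H ∘ₗ
            (HopfAlgebra.antipode ℂ (A := H)).lTensor H)
          (fun s x hx y hy => ?_) (hΔ r l a a.2)
        simp [hmul hx (hS s l y hy), phaseTheta, phase_neg_right, phase_self hθ]
      · rw [HopfAlgebra.mul_antipode_lTensor_comul_apply, Algebra.algebraMap_eq_smul_one,
          hphase.1]

end
end

section
/- In the *-algebra A(S⁷_{θ′}), the matrix Ψ satisfies Ψ†Ψ = I₂ (the 2×2 identity matrix over A(S⁷_{θ′})), and consequently the 4×4 matrix p = ΨΨ† is a projection: p² = p and p† = p; moreover every entry of p lies in the *-subalgebra of A(S⁷_{θ′}) generated by ζ₀ = ψ₁ψ₁* + ψ₂*ψ₂, ζ₁ = ψ₁ψ₃* + ψ₂*ψ₄ and ζ₂ = ψ₂ψ₃* − ψ₁*ψ₄. -/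
/- Statement 17: In the *-algebra A(S⁷_{θ'}) (presented here by its generators and
relations inside an arbitrary unital ℂ-*-algebra), the matrix Ψ satisfies Ψ†Ψ = I₂, so
p = ΨΨ† is a projection (p² = p, p† = p), and every entry of p lies in the
*-subalgebra generated by ζ₀, ζ₁, ζ₂. -/

open scoped Matrix

noncomputable section

/-- `μ = e^{πiθ}`. -/
def mu (θ : ℝ) : ℂ := Complex.exp ((Real.pi : ℂ) * Complex.I * (θ : ℂ))

/-- The matrix of deformation parameters `λ'_{ab}` of the sphere `S⁷_{θ'}`. -/
def lam' (θ : ℝ) : Matrix (Fin 4) (Fin 4) ℂ :=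
  !![1, 1, star (mu θ), mu θ;
     1, 1, mu θ, star (mu θ);
     mu θ, star (mu θ), 1, 1;
     star (mu θ), mu θ, 1, 1]

/-- The 4×2 matrix `Ψ` of generators. -/
def Psi {A : Type} [Ring A] [StarRing A] (ψ : Fin 4 → A) : Matrix (Fin 4) (Fin 2) A :=
  !![ψ 0, -star (ψ 1);
     ψ 1, star (ψ 0);
     ψ 2, -star (ψ 3);
     ψ 3, star (ψ 2)]

/-- `μ` has modulus one. -/
theorem star_mu_mul_mu (θ : ℝ) : star (mu θ) * mu θ = 1 := by
  have h : (Real.pi : ℂ) * Complex.I * (θ : ℂ) = ((Real.pi * θ : ℝ) : ℂ) * Complex.I := by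
    push_cast; ring
  rw [Complex.star_def, mu, h, Complex.conj_mul', Complex.norm_exp_ofReal_mul_I]
  simp

theorem projection_of_instanton_bundle
    {A : Type} [Ring A] [Algebra ℂ A] [StarRing A] [StarModule ℂ A]
    (θ : ℝ) (ψ : Fin 4 → A)
    -- the commutation relations of `A(S⁷_{θ'})`
    (hrel1 : ∀ a b, ψ a * ψ b = lam' θ a b • (ψ b * ψ a))
    (hrel2 : ∀ a b, ψ a * star (ψ b) = lam' θ b a • (star (ψ b) * ψ a))
    (hrel3 : ∀ a b, star (ψ a) * star (ψ b) = lam' θ a b • (star (ψ b) * star (ψ a)))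
    -- the sphere relation
    (hsph : ∑ a, star (ψ a) * ψ a = 1) :
    (Psi ψ)ᴴ * Psi ψ = (1 : Matrix (Fin 2) (Fin 2) A) ∧
    (Psi ψ * (Psi ψ)ᴴ) * (Psi ψ * (Psi ψ)ᴴ) = Psi ψ * (Psi ψ)ᴴ ∧
    (Psi ψ * (Psi ψ)ᴴ)ᴴ = Psi ψ * (Psi ψ)ᴴ ∧
    (∀ m n, (Psi ψ * (Psi ψ)ᴴ) m n ∈
      StarAlgebra.adjoin ℂ
        ({ψ 0 * star (ψ 0) + star (ψ 1) * ψ 1,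
          ψ 0 * star (ψ 2) + star (ψ 1) * ψ 3,
          ψ 1 * star (ψ 2) - star (ψ 0) * ψ 3} : Set A)) := by
  have comm : ∀ a, ψ a * star (ψ a) = star (ψ a) * ψ a := fun a => by
    rw [hrel2 a a]; fin_cases a <;> simp [lam']
  have hμ := star_mu_mul_mu θ
  have hμ' : mu θ * star (mu θ) = 1 := by rw [mul_comm, hμ]
  have h01 : ψ 0 * star (ψ 1) = star (ψ 1) * ψ 0 := by simpa [lam'] using hrel2 0 1
  have h23 : ψ 2 * star (ψ 3) = star (ψ 3) * ψ 2 := by simpa [lam'] using hrel2 2 3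
  have hs01 : star (ψ 0) * star (ψ 1) = star (ψ 1) * star (ψ 0) := by
    simpa [lam'] using hrel3 0 1
  have hs23 : star (ψ 2) * star (ψ 3) = star (ψ 3) * star (ψ 2) := by
    simpa [lam'] using hrel3 2 3
  have hp01 : ψ 0 * ψ 1 = ψ 1 * ψ 0 := by simpa [lam'] using hrel1 0 1
  have hp23 : ψ 2 * ψ 3 = ψ 3 * ψ 2 := by simpa [lam'] using hrel1 2 3
  have h03 : ψ 0 * star (ψ 3) = star (mu θ) • (star (ψ 3) * ψ 0) := by
    simpa [lam'] using hrel2 0 3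
  have h21 : ψ 2 * star (ψ 1) = mu θ • (star (ψ 1) * ψ 2) := by
    simpa [lam'] using hrel2 2 1
  have h13 : ψ 1 * star (ψ 3) = mu θ • (star (ψ 3) * ψ 1) := by
    simpa [lam'] using hrel2 1 3
  have h20 : ψ 2 * star (ψ 0) = star (mu θ) • (star (ψ 0) * ψ 2) := by
    simpa [lam'] using hrel2 2 0
  rw [Fin.sum_univ_four] at hsph
  have hortho : (Psi ψ)ᴴ * Psi ψ = (1 : Matrix (Fin 2) (Fin 2) A) := by
    ext i j
    fin_cases i <;> fin_cases j <;>
      simp [Psi, Matrix.mul_apply, Fin.sum_univ_four, Matrix.conjTranspose_apply]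
    · exact hsph
    · rw [hs01, hs23]; abel
    · rw [hp01, hp23]; abel
    · rw [comm, comm, comm, comm, ← hsph]; abel
  have hself : (Psi ψ * (Psi ψ)ᴴ)ᴴ = Psi ψ * (Psi ψ)ᴴ :=
    Matrix.isHermitian_mul_conjTranspose_self _
  refine ⟨hortho, ?_, hself, ?_⟩
  · rw [Matrix.mul_assoc, ← Matrix.mul_assoc (Psi ψ)ᴴ, hortho, Matrix.one_mul]
  set S : Set A := {ψ 0 * star (ψ 0) + star (ψ 1) * ψ 1,
    ψ 0 * star (ψ 2) + star (ψ 1) * ψ 3, ψ 1 * star (ψ 2) - star (ψ 0) * ψ 3} with hS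
  have hζ₀ : ψ 0 * star (ψ 0) + star (ψ 1) * ψ 1 ∈ StarAlgebra.adjoin ℂ S :=
    StarAlgebra.subset_adjoin ℂ S (by simp [hS])
  have hζ₁ : ψ 0 * star (ψ 2) + star (ψ 1) * ψ 3 ∈ StarAlgebra.adjoin ℂ S :=
    StarAlgebra.subset_adjoin ℂ S (by simp [hS])
  have hζ₂ : ψ 1 * star (ψ 2) - star (ψ 0) * ψ 3 ∈ StarAlgebra.adjoin ℂ S :=
    StarAlgebra.subset_adjoin ℂ S (by simp [hS])
  have entry : ∀ m n, (Psi ψ * (Psi ψ)ᴴ) m n =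
      Psi ψ m 0 * star (Psi ψ n 0) + Psi ψ m 1 * star (Psi ψ n 1) := fun m n => by
    simp [Matrix.mul_apply, Fin.sum_univ_two, Matrix.conjTranspose_apply]
  have upper : ∀ m n, m ≤ n → (Psi ψ * (Psi ψ)ᴴ) m n ∈ StarAlgebra.adjoin ℂ S := by
    have e11 : ψ 1 * star (ψ 1) + star (ψ 0) * ψ 0 =
        ψ 0 * star (ψ 0) + star (ψ 1) * ψ 1 := by rw [comm, comm]; abel
    have e22 : ψ 2 * star (ψ 2) + star (ψ 3) * ψ 3 =
        1 - (ψ 0 * star (ψ 0) + star (ψ 1) * ψ 1) := by rw [comm, comm, ← hsph]; abel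
    have e33 : ψ 3 * star (ψ 3) + star (ψ 2) * ψ 2 =
        1 - (ψ 0 * star (ψ 0) + star (ψ 1) * ψ 1) := by rw [comm, comm, ← hsph]; abel
    have e03 : ψ 0 * star (ψ 3) - star (ψ 1) * ψ 2 =
        -(star (mu θ) • star (ψ 1 * star (ψ 2) - star (ψ 0) * ψ 3)) := by
      rw [star_sub, star_mul, star_mul, star_star, star_star, h21, h03, smul_sub, smul_smul,
        hμ, one_smul, neg_sub]
    have e13 : ψ 1 * star (ψ 3) + star (ψ 0) * ψ 2 =
        mu θ • star (ψ 0 * star (ψ 2) + star (ψ 1) * ψ 3) := by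
      rw [star_add, star_mul, star_mul, star_star, star_star, h20, h13, smul_add, smul_smul,
        hμ', one_smul, add_comm]
    intro m n hmn
    rw [entry]
    fin_cases m <;> fin_cases n <;> first | (exact absurd hmn (by decide)) | simp [Psi]
    · exact hζ₀
    · rw [h01, add_neg_cancel]; exact zero_mem _
    · exact hζ₁
    · rw [← sub_eq_add_neg, e03]
      exact neg_mem (SMulMemClass.smul_mem _ (star_mem hζ₂))
    · rw [e11]; exact hζ₀
    · rw [← sub_eq_add_neg]; exact hζ₂
    · rw [e13]; exact SMulMemClass.smul_mem _ (star_mem hζ₁)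
    · rw [e22]; exact sub_mem (one_mem _) hζ₀
    · rw [h23, add_neg_cancel]; exact zero_mem _
    · rw [e33]; exact sub_mem (one_mem _) hζ₀
  intro m n
  rcases le_total m n with h | h
  · exact upper m n h
  · rw [← hself, Matrix.conjTranspose_apply]
    exact star_mem (upper n m h)

end
end

section
/- Let A = A(S⁷_{θ′}) and equip A⊗A with the product (x⊗x̃)•(y⊗ỹ) = xy⊗ỹx̃. Define Z₀ = ψ₁⊗ψ₁* + ψ₂*⊗ψ₂, X₀ = ψ₂⊗ψ₁* − ψ₁*⊗ψ₂, W₀ = ψ₃⊗ψ₃* + ψ₄*⊗ψ₄, Y₀ = ψ₄⊗ψ₃* − ψ₃*⊗ψ₄, Z₁ = ψ₃⊗ψ₁* + ψ₄*⊗ψ₂, W₁ = ψ₄⊗ψ₁* − ψ₃*⊗ψ₂, Z₂ = ψ₁⊗ψ₃* + ψ₂*⊗ψ₄, W₂ = ψ₂⊗ψ₃* − ψ₁*⊗ψ₄, with tildes given by the involution (x⊗y)~ = x*⊗y* (so Z̃ᵢ = Zᵢ*, etc.), and set ζ₀ = ψ₁ψ₁* + ψ₂*ψ₂ ∈ A.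 Then the following four 'sphere relations' hold in A⊗A (products taken with •): Z̃₀•Z₀ + X̃₀•X₀ = Z₀•Z̃₀ + X₀•X̃₀ = ζ₀⊗ζ₀; W̃₀•W₀ + Ỹ₀•Y₀ = W₀•W̃₀ + Y₀•Ỹ₀ = (1−ζ₀)⊗(1−ζ₀); Z̃₁•Z₁ + W̃₁•W₁ = Z₁•Z̃₁ + W₁•W̃₁ = (1−ζ₀)⊗ζ₀; Z̃₂•Z₂ + W̃₂•W₂ = Z₂•Z̃₂ + W₂•W̃₂ = ζ₀⊗(1−ζ₀). -/
/- Statement 19: The four 'sphere relations' among the generators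
Z₀, X₀, W₀, Y₀, Z₁, W₁, Z₂, W₂ (and their conjugates) of the Ehresmann–Schauenburg
bialgebroid of the bundle A(S⁷_{θ'}), computed in `A ⊗ A^{op}` with the product
`(x⊗x̃)•(y⊗ỹ) = xy ⊗ ỹx̃`. -/

open scoped TensorProduct

noncomputable section

variable {A : Type} [Ring A] [Algebra ℂ A] [StarRing A] [StarModule ℂ A]

open MulOpposite in
/-- `x ⊗ y` as an element of `A ⊗ A^{op}`. -/
def tO (x y : A) : A ⊗[ℂ] Aᵐᵒᵖ := x ⊗ₜ[ℂ] (op y)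

def Z0 (ψ : Fin 4 → A) : A ⊗[ℂ] Aᵐᵒᵖ := tO (ψ 0) (star (ψ 0)) + tO (star (ψ 1)) (ψ 1)
def Z0t (ψ : Fin 4 → A) : A ⊗[ℂ] Aᵐᵒᵖ := tO (star (ψ 0)) (ψ 0) + tO (ψ 1) (star (ψ 1))
def X0 (ψ : Fin 4 → A) : A ⊗[ℂ] Aᵐᵒᵖ := tO (ψ 1) (star (ψ 0)) - tO (star (ψ 0)) (ψ 1)
def X0t (ψ : Fin 4 → A) : A ⊗[ℂ] Aᵐᵒᵖ := tO (star (ψ 1)) (ψ 0) - tO (ψ 0) (star (ψ 1))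
def W0 (ψ : Fin 4 → A) : A ⊗[ℂ] Aᵐᵒᵖ := tO (ψ 2) (star (ψ 2)) + tO (star (ψ 3)) (ψ 3)
def W0t (ψ : Fin 4 → A) : A ⊗[ℂ] Aᵐᵒᵖ := tO (star (ψ 2)) (ψ 2) + tO (ψ 3) (star (ψ 3))
def Y0 (ψ : Fin 4 → A) : A ⊗[ℂ] Aᵐᵒᵖ := tO (ψ 3) (star (ψ 2)) - tO (star (ψ 2)) (ψ 3)
def Y0t (ψ : Fin 4 → A) : A ⊗[ℂ] Aᵐᵒᵖ := tO (star (ψ 3)) (ψ 2) - tO (ψ 2) (star (ψ 3))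
def Z1 (ψ : Fin 4 → A) : A ⊗[ℂ] Aᵐᵒᵖ := tO (ψ 2) (star (ψ 0)) + tO (star (ψ 3)) (ψ 1)
def Z1t (ψ : Fin 4 → A) : A ⊗[ℂ] Aᵐᵒᵖ := tO (star (ψ 2)) (ψ 0) + tO (ψ 3) (star (ψ 1))
def W1 (ψ : Fin 4 → A) : A ⊗[ℂ] Aᵐᵒᵖ := tO (ψ 3) (star (ψ 0)) - tO (star (ψ 2)) (ψ 1)
def W1t (ψ : Fin 4 → A) : A ⊗[ℂ] Aᵐᵒᵖ := tO (star (ψ 3)) (ψ 0) - tO (ψ 2) (star (ψ 1))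
def Z2 (ψ : Fin 4 → A) : A ⊗[ℂ] Aᵐᵒᵖ := tO (ψ 0) (star (ψ 2)) + tO (star (ψ 1)) (ψ 3)
def Z2t (ψ : Fin 4 → A) : A ⊗[ℂ] Aᵐᵒᵖ := tO (ψ 1) (star (ψ 3)) + tO (star (ψ 0)) (ψ 2)
def W2 (ψ : Fin 4 → A) : A ⊗[ℂ] Aᵐᵒᵖ := tO (ψ 1) (star (ψ 2)) - tO (star (ψ 0)) (ψ 3)
def W2t (ψ : Fin 4 → A) : A ⊗[ℂ] Aᵐᵒᵖ := tO (star (ψ 1)) (ψ 2) - tO (ψ 0) (star (ψ 3))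

/-- `ζ₀ = ψ₁ψ₁* + ψ₂*ψ₂`. -/
def zeta0 (ψ : Fin 4 → A) : A := ψ 0 * star (ψ 0) + star (ψ 1) * ψ 1

/-- The sphere relation attached to two pairs `x, y` and `u, v` of commuting normal elements. -/
lemma tO_sphere_relation {x y u v : A}
    (hx : x * star x = star x * x) (hy : y * star y = star y * y)
    (hxy : x * y = y * x) (hxy' : star x * star y = star y * star x)
    (hu : u * star u = star u * u) (hv : v * star v = star v * v)
    (huv : u * v = v * u) (huv' : star u * star v = star v * star u) :
    (tO (star x) u + tO y (star v)) * (tO x (star u) + tO (star y) v) +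
        (tO (star y) u - tO x (star v)) * (tO y (star u) - tO (star x) v) =
      tO (x * star x + star y * y) (u * star u + star v * v) ∧
    (tO x (star u) + tO (star y) v) * (tO (star x) u + tO y (star v)) +
        (tO y (star u) - tO (star x) v) * (tO (star y) u - tO x (star v)) =
      tO (x * star x + star y * y) (u * star u + star v * v) := by
  constructor <;>
  · simp only [tO, mul_add, add_mul, mul_sub, sub_mul, Algebra.TensorProduct.tmul_mul_tmul,
      ← MulOpposite.op_mul, MulOpposite.op_add, TensorProduct.add_tmul, TensorProduct.tmul_add,
      hx, hy, hxy, hxy', hu, hv, huv, huv']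
    abel

theorem sphere_relations
    (θ : ℝ) (ψ : Fin 4 → A)
    (hrel1 : ∀ a b, ψ a * ψ b = lam' θ a b • (ψ b * ψ a))
    (hrel2 : ∀ a b, ψ a * star (ψ b) = lam' θ b a • (star (ψ b) * ψ a))
    (hrel3 : ∀ a b, star (ψ a) * star (ψ b) = lam' θ a b • (star (ψ b) * star (ψ a)))
    (hsph : ∑ a, star (ψ a) * ψ a = 1) :
    (Z0t ψ * Z0 ψ + X0t ψ * X0 ψ = tO (zeta0 ψ) (zeta0 ψ) ∧
      Z0 ψ * Z0t ψ + X0 ψ * X0t ψ = tO (zeta0 ψ) (zeta0 ψ)) ∧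
    (W0t ψ * W0 ψ + Y0t ψ * Y0 ψ = tO (1 - zeta0 ψ) (1 - zeta0 ψ) ∧
      W0 ψ * W0t ψ + Y0 ψ * Y0t ψ = tO (1 - zeta0 ψ) (1 - zeta0 ψ)) ∧
    (Z1t ψ * Z1 ψ + W1t ψ * W1 ψ = tO (1 - zeta0 ψ) (zeta0 ψ) ∧
      Z1 ψ * Z1t ψ + W1 ψ * W1t ψ = tO (1 - zeta0 ψ) (zeta0 ψ)) ∧
    (Z2t ψ * Z2 ψ + W2t ψ * W2 ψ = tO (zeta0 ψ) (1 - zeta0 ψ) ∧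
      Z2 ψ * Z2t ψ + W2 ψ * W2t ψ = tO (zeta0 ψ) (1 - zeta0 ψ)) := by
  have hc (a b : Fin 4) (h : lam' θ a b = 1) : ψ a * ψ b = ψ b * ψ a := by
    rw [hrel1, h, one_smul]
  have hc' (a b : Fin 4) (h : lam' θ a b = 1) :
      star (ψ a) * star (ψ b) = star (ψ b) * star (ψ a) := by
    rw [hrel3, h, one_smul]
  have hn (a : Fin 4) : ψ a * star (ψ a) = star (ψ a) * ψ a := by
    have h : lam' θ a a = 1 := by fin_cases a <;> rfl
    rw [hrel2, h, one_smul]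
  have h01 : lam' θ 0 1 = 1 := rfl
  have h23 : lam' θ 2 3 = 1 := rfl
  have hzeta : 1 - zeta0 ψ = ψ 2 * star (ψ 2) + star (ψ 3) * ψ 3 := by
    rw [← hsph, Fin.sum_univ_four, zeta0, hn 0, hn 2]
    abel
  rw [hzeta]
  refine ⟨?_, ?_, ?_, ?_⟩
  · exact tO_sphere_relation (hn 0) (hn 1) (hc 0 1 h01) (hc' 0 1 h01)
      (hn 0) (hn 1) (hc 0 1 h01) (hc' 0 1 h01)
  · exact tO_sphere_relation (hn 2) (hn 3) (hc 2 3 h23) (hc' 2 3 h23)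
      (hn 2) (hn 3) (hc 2 3 h23) (hc' 2 3 h23)
  · exact tO_sphere_relation (hn 2) (hn 3) (hc 2 3 h23) (hc' 2 3 h23)
      (hn 0) (hn 1) (hc 0 1 h01) (hc' 0 1 h01)
  · rw [Z2t, add_comm (tO (ψ 1) _)]
    exact tO_sphere_relation (hn 0) (hn 1) (hc 0 1 h01) (hc' 0 1 h01)
      (hn 2) (hn 3) (hc 2 3 h23) (hc' 2 3 h23)

end
end
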